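/- Let n ≥ 1, m ≥ 1, q ≥ 1, let A ∈ ℝ^{n×n} be nilpotent, let B_1,…,B_q ∈ ℝ^{n×m}, set B = B_1 + ⋯ + B_q, and assume the pair (A,B) is controllable. Let τ̄ > 0 and d ∈ [0,1), and let τ_1,…,τ_q : [0,∞) → ℝ be differentiable with 0 ≤ τ_i(t) ≤ τ̄ and τ_i′(t) ≤ d for all t ≥ 0 and all i. Let γ₀ > 0, ω > 0, μ ∈ (0,1) and define γ(t) = γ₀/(ωt+1)^μ for t ≥ 0. For each γ > 0 let P(γ) be the unique symmetric positive definite solution of the PLE. Suppose x : [−τ̄,∞) → ℝⁿ is continuous and differentiable on [0,∞), u : [−τ̄,∞) → ℝ^m is bounded on [−τ̄,0) and satisfies u(t) = −Bᵀ P(γ(t)) x(t) for all t ≥ 0, and ẋ(t) = A x(t) + Σ_{i=1}^{q} B_i u(t − τ_i(t)) for all t ≥ 0. Then x(t) → 0 as t → ∞. -/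

import Mathlib

open Matrix Filter

/-- The pair `(A, B)` is controllable: the Kalman matrix
`[B, AB, A²B, …, A^{n−1}B]` has rank `n`. -/
def Controllable {n m : ℕ} (A : Matrix (Fin n) (Fin n) ℝ)
    (B : Matrix (Fin n) (Fin m) ℝ) : Prop :=
  (Matrix.of fun (i : Fin n) (p : Fin n × Fin m) => (A ^ (p.1 : ℕ) * B) i p.2).rank = n

/-- `P` is a symmetric positive definite solution of the parametric Lyapunov equation
`AᵀP + PA − PBBᵀP = −γP`. -/
def IsPLESol {n m : ℕ} (A : Matrix (Fin n) (Fin n) ℝ) (B : Matrix (Fin n) (Fin m) ℝ)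
    (γ : ℝ) (P : Matrix (Fin n) (Fin n) ℝ) : Prop :=
  P.IsSymm ∧ P.PosDef ∧ Aᵀ * P + P * A - P * B * Bᵀ * P = -(γ • P)

namespace ParametricLyapunov

open scoped Matrix.Norms.Operator

section Norms

variable {ι κ : Type*} [Fintype ι] [Fintype κ]

lemma abs_entry_le_norm (X : Matrix ι κ ℝ) (i : ι) (j : κ) : |X i j| ≤ ‖X‖ := by
  have h1 : ‖X i j‖₊ ≤ ∑ j, ‖X i j‖₊ :=
    Finset.single_le_sum (f := fun j => ‖X i j‖₊) (fun _ _ => zero_le) (Finset.mem_univ j)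
  have h2 : ∑ j, ‖X i j‖₊ ≤ Finset.univ.sup fun i => ∑ j, ‖X i j‖₊ :=
    Finset.le_sup (f := fun i => ∑ j, ‖X i j‖₊) (Finset.mem_univ i)
  rw [Matrix.linfty_opNorm_def, ← Real.norm_eq_abs, ← coe_nnnorm]
  exact_mod_cast h1.trans h2

lemma norm_le_card_mul {X : Matrix ι κ ℝ} {c : ℝ} (hc : 0 ≤ c) (h : ∀ i j, |X i j| ≤ c) :
    ‖X‖ ≤ Fintype.card κ * c := by
  lift c to NNReal using hc
  rw [Matrix.linfty_opNorm_def]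
  have : (Finset.univ.sup fun i => ∑ j, ‖X i j‖₊) ≤ Fintype.card κ * c := by
    refine Finset.sup_le fun i _ => ?_
    calc ∑ j, ‖X i j‖₊ ≤ ∑ _j : κ, c := Finset.sum_le_sum fun j _ => by
          have := h i j
          rw [← Real.norm_eq_abs, ← coe_nnnorm] at this
          exact_mod_cast this
      _ = Fintype.card κ * c := by simp
  exact_mod_cast this

lemma abs_dotProduct_le (v w : ι → ℝ) : |v ⬝ᵥ w| ≤ Fintype.card ι * (‖v‖ * ‖w‖) := by
  calc |v ⬝ᵥ w| ≤ ∑ i, |v i * w i| := Finset.abs_sum_le_sum_abs _ _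
    _ ≤ ∑ _i : ι, ‖v‖ * ‖w‖ := Finset.sum_le_sum fun i _ => by
        rw [abs_mul]
        exact mul_le_mul (norm_le_pi_norm v i) (norm_le_pi_norm w i) (abs_nonneg _)
          (norm_nonneg _)
    _ = _ := by simp

lemma norm_sq_le_dotProduct_self (v : ι → ℝ) : ‖v‖ ^ 2 ≤ v ⬝ᵥ v := by
  have h0 : 0 ≤ v ⬝ᵥ v := Finset.sum_nonneg fun i _ => mul_self_nonneg (v i)
  have : ‖v‖ ≤ √(v ⬝ᵥ v) := by
    refine (pi_norm_le_iff_of_nonneg (Real.sqrt_nonneg _)).2 fun i => ?_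
    rw [Real.norm_eq_abs]
    refine Real.abs_le_sqrt ?_
    rw [sq]
    exact Finset.single_le_sum (f := fun i => v i * v i) (fun i _ => mul_self_nonneg (v i))
      (Finset.mem_univ i)
  calc ‖v‖ ^ 2 ≤ √(v ⬝ᵥ v) ^ 2 := by gcongr
    _ = _ := Real.sq_sqrt h0

lemma sq_entry_le_trace (X : Matrix ι κ ℝ) (i : ι) (j : κ) : X i j ^ 2 ≤ (X * Xᵀ).trace := by
  have h : (X * Xᵀ).trace = ∑ i, ∑ j, X i j ^ 2 := by
    simp [Matrix.trace, Matrix.mul_apply, sq]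
  rw [h]
  calc X i j ^ 2 ≤ ∑ j, X i j ^ 2 :=
        Finset.single_le_sum (f := fun j => X i j ^ 2) (fun _ _ => sq_nonneg _) (Finset.mem_univ j)
    _ ≤ _ := Finset.single_le_sum (f := fun i => ∑ j, X i j ^ 2)
        (fun _ _ => Finset.sum_nonneg fun _ _ => sq_nonneg _) (Finset.mem_univ i)

end Norms

section Resolvent

lemma eq_sum_of_nilpotent {E : Type*} [AddCommGroup E] [Module ℝ E] {l : Module.End ℝ E} {N : ℕ}
    (hl : l ^ N = 0) {g : ℝ} (hg : g ≠ 0) {X Y : E} (h : l X + g • X = Y) :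
    X = ∑ k ∈ Finset.range N, ((-1) ^ k * g⁻¹ ^ (k + 1)) • (l ^ k) Y := by
  have key := geom_sum_mul_neg (-(g⁻¹ • l)) N
  have h0 : (-(g⁻¹ • l)) ^ N = 0 := by
    rw [neg_pow, smul_pow, hl]; simp
  rw [h0, sub_zero] at key
  have h1 : (1 - -(g⁻¹ • l)) X = g⁻¹ • Y := by
    rw [← h]
    simp [smul_smul, hg, add_comm]
  have h2 := congrArg (fun f : Module.End ℝ E => f X) key
  simp only [Module.End.mul_apply, h1, Module.End.one_apply] at h2
  rw [← h2, LinearMap.sum_apply]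
  refine Finset.sum_congr rfl fun k _ => ?_
  rw [map_smul, neg_pow, smul_pow]
  rcases Nat.even_or_odd k with hk | hk
  · simp [hk.neg_one_pow, smul_smul, pow_succ, mul_comm]
  · simp [hk.neg_one_pow, smul_smul, pow_succ, mul_comm]

variable {n : ℕ}

/-- The Lyapunov operator `X ↦ AX + XAᵀ`. -/
noncomputable def lyap (A : Matrix (Fin n) (Fin n) ℝ) : Module.End ℝ (Matrix (Fin n) (Fin n) ℝ) :=
  LinearMap.mulLeft ℝ A + LinearMap.mulRight ℝ Aᵀ

lemma lyap_apply (A X : Matrix (Fin n) (Fin n) ℝ) : lyap A X = A * X + X * Aᵀ := rfl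

lemma lyap_pow_eq_zero {A : Matrix (Fin n) (Fin n) ℝ} {p : ℕ} (hA : A ^ p = 0) :
    lyap A ^ (2 * p) = 0 := by
  refine (LinearMap.commute_mulLeft_right A Aᵀ).add_pow_eq_zero_of_add_le_succ_of_pow_eq_zero
    (m := p) (n := p) ?_ ?_ (by omega)
  · rw [LinearMap.pow_mulLeft, hA]; simp
  · rw [LinearMap.pow_mulRight, ← Matrix.transpose_pow, hA]; simp

lemma norm_lyap_pow_le (A X : Matrix (Fin n) (Fin n) ℝ) (k : ℕ) :
    ‖(lyap A ^ k) X‖ ≤ (‖A‖ + ‖Aᵀ‖) ^ k * ‖X‖ := by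
  induction k with
  | zero => simp
  | succ k ih =>
    rw [pow_succ', Module.End.mul_apply, lyap_apply]
    calc _ ≤ ‖A‖ * ‖(lyap A ^ k) X‖ + ‖(lyap A ^ k) X‖ * ‖Aᵀ‖ :=
          (norm_add_le _ _).trans (add_le_add (norm_mul_le _ _) (norm_mul_le _ _))
      _ = (‖A‖ + ‖Aᵀ‖) * ‖(lyap A ^ k) X‖ := by ring
      _ ≤ (‖A‖ + ‖Aᵀ‖) * ((‖A‖ + ‖Aᵀ‖) ^ k * ‖X‖) := by gcongr
      _ = _ := by ring

end Resolvent

section Scaled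

variable {n m : ℕ}

open scoped MatrixOrder Matrix.Norms.L2Operator in
lemma exists_factor {P : Matrix (Fin n) (Fin n) ℝ} (h : P.PosDef) :
    ∃ M : Matrix (Fin n) (Fin n) ℝ, IsUnit M.det ∧ P = Mᵀ * M := by
  obtain ⟨M, hM⟩ := CStarAlgebra.nonneg_iff_eq_star_mul_self.1 h.posSemidef.nonneg
  rw [Matrix.star_eq_conjTranspose, Matrix.conjTranspose_eq_transpose_of_trivial] at hM
  refine ⟨M, ?_, hM⟩
  have h1 := (Matrix.isUnit_iff_isUnit_det _).1 h.isUnit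
  rw [hM, Matrix.det_mul] at h1
  exact isUnit_of_mul_isUnit_right h1

lemma scaled_equation {A : Matrix (Fin n) (Fin n) ℝ} {B : Matrix (Fin n) (Fin m) ℝ} {g : ℝ}
    {M : Matrix (Fin n) (Fin n) ℝ} (hM : IsUnit M.det) (hP : IsPLESol A B g (Mᵀ * M)) :
    (M * A * M⁻¹)ᵀ + M * A * M⁻¹ - (M * B) * (M * B)ᵀ = -(g • 1) := by
  have hMT : IsUnit Mᵀ.det := by rwa [Matrix.det_transpose]
  have h1 : M⁻¹ * M = 1 := Matrix.nonsing_inv_mul _ hM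
  have h2 : Mᵀ * (Mᵀ)⁻¹ = 1 := Matrix.mul_nonsing_inv _ hMT
  have h1' : M * M⁻¹ = 1 := Matrix.mul_nonsing_inv _ hM
  have h2' : (Mᵀ)⁻¹ * Mᵀ = 1 := Matrix.nonsing_inv_mul _ hMT
  have h3 := congrArg (fun X => (Mᵀ)⁻¹ * X * M⁻¹) hP.2.2
  simp only [Matrix.mul_sub, Matrix.mul_add, Matrix.sub_mul, Matrix.add_mul, Matrix.mul_neg,
    Matrix.neg_mul, Matrix.mul_smul, Matrix.smul_mul] at h3
  have e1 : (Mᵀ)⁻¹ * (Aᵀ * (Mᵀ * M)) * M⁻¹ = (M * A * M⁻¹)ᵀ := by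
    rw [Matrix.transpose_mul, Matrix.transpose_mul, Matrix.transpose_nonsing_inv]
    simp only [Matrix.mul_assoc, h1', Matrix.mul_one]
  have e2 : (Mᵀ)⁻¹ * (Mᵀ * M * A) * M⁻¹ = M * A * M⁻¹ := by
    simp only [← Matrix.mul_assoc, h2', Matrix.one_mul]
  have e3 : (Mᵀ)⁻¹ * (Mᵀ * M * B * Bᵀ * (Mᵀ * M)) * M⁻¹ = (M * B) * (M * B)ᵀ := by
    calc _ = ((Mᵀ)⁻¹ * Mᵀ) * M * B * Bᵀ * Mᵀ * (M * M⁻¹) := by simp only [Matrix.mul_assoc]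
      _ = _ := by rw [h1', h2', Matrix.transpose_mul]; simp only [Matrix.mul_assoc, Matrix.one_mul,
                    Matrix.mul_one]
  have e4 : (Mᵀ)⁻¹ * (Mᵀ * M) * M⁻¹ = 1 := by
    calc _ = ((Mᵀ)⁻¹ * Mᵀ) * (M * M⁻¹) := by simp only [Matrix.mul_assoc]
      _ = 1 := by rw [h1', h2', Matrix.one_mul]
  rwa [e1, e2, e3, e4] at h3

lemma trace_eq_zero_of_isNilpotent {a : Matrix (Fin n) (Fin n) ℝ} (ha : IsNilpotent a) :
    a.trace = 0 :=
  (Matrix.isNilpotent_trace_of_isNilpotent ha).eq_zero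

lemma trace_mul_transpose_eq {a : Matrix (Fin n) (Fin n) ℝ} {b : Matrix (Fin n) (Fin m) ℝ} {g : ℝ}
    (ha : IsNilpotent a) (h : aᵀ + a - b * bᵀ = -(g • 1)) : (b * bᵀ).trace = n * g := by
  have h1 := congrArg Matrix.trace h
  simp [Matrix.trace_sub, Matrix.trace_add, Matrix.trace_neg, Matrix.trace_smul,
    Matrix.trace_transpose, trace_eq_zero_of_isNilpotent ha] at h1
  linarith

lemma abs_entry_input_le {a : Matrix (Fin n) (Fin n) ℝ} {b : Matrix (Fin n) (Fin m) ℝ} {g : ℝ}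
    (ha : IsNilpotent a) (h : aᵀ + a - b * bᵀ = -(g • 1)) (i : Fin n) (j : Fin m) :
    |b i j| ≤ √(n * g) :=
  Real.abs_le_sqrt ((sq_entry_le_trace b i j).trans_eq (trace_mul_transpose_eq ha h))

lemma abs_entry_state_le {a : Matrix (Fin n) (Fin n) ℝ} {b : Matrix (Fin n) (Fin m) ℝ} {g : ℝ}
    (hg : 0 < g) (ha : IsNilpotent a) (h : aᵀ + a - b * bᵀ = -(g • 1)) (i j : Fin n) :
    |a i j| ≤ n * (m * (n * g)) := by
  have htr := trace_mul_transpose_eq ha h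
  have hng : 0 ≤ (n : ℝ) * g := by positivity
  set c := b * bᵀ with hc
  have hc_entry : ∀ i j, |c i j| ≤ m * (n * g) := fun i j => by
    rw [hc, Matrix.mul_apply]
    calc _ ≤ ∑ k, |b i k * bᵀ k j| := Finset.abs_sum_le_sum_abs _ _
      _ ≤ ∑ _k : Fin m, (n * g) := Finset.sum_le_sum fun k _ => by
          rw [abs_mul, ← Real.mul_self_sqrt hng]
          exact mul_le_mul (abs_entry_input_le ha h i k) (abs_entry_input_le ha h j k)
            (abs_nonneg _) (Real.sqrt_nonneg _)
      _ = _ := by simp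
  have hcT : cᵀ = c := by simp [hc]
  have hcc : (c * c).trace ≤ (n * (m * (n * g))) ^ 2 := by
    calc (c * c).trace = ∑ i, ∑ j, c i j * c j i := by simp [Matrix.trace, Matrix.mul_apply]
      _ ≤ ∑ _i : Fin n, ∑ _j : Fin n, (m * (n * g)) * (m * (n * g)) :=
          Finset.sum_le_sum fun i _ => Finset.sum_le_sum fun j _ => by
            refine (le_abs_self _).trans ?_
            rw [abs_mul]
            exact mul_le_mul (hc_entry i j) (hc_entry j i) (abs_nonneg _) (by positivity)
      _ = _ := by simp; ring
  have haT : aᵀ = c - g • 1 - a := by rw [← sub_eq_zero] at h ⊢; rw [← h]; abel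
  have ha2 : (a * a).trace = 0 := by
    rw [← sq]
    refine trace_eq_zero_of_isNilpotent (ha.pow_of_pos (by norm_num))
  have h1 : (a * aᵀ).trace = (a * c).trace := by
    rw [haT]
    simp [Matrix.mul_sub, Matrix.trace_sub, Matrix.trace_smul, ha2,
      trace_eq_zero_of_isNilpotent ha]
  have h2 : (aᵀ * c).trace = (a * c).trace := by
    rw [← Matrix.trace_transpose, Matrix.transpose_mul, Matrix.transpose_transpose, hcT,
      Matrix.trace_mul_comm]
  have h3 : (aᵀ * c).trace = (c * c).trace - g * (n * g) - (a * c).trace := by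
    rw [haT]
    simp [Matrix.sub_mul, Matrix.trace_sub, Matrix.trace_smul, htr]
  have hgg : 0 ≤ g * (n * g) := by positivity
  have h4 : (a * aᵀ).trace ≤ (n * (m * (n * g))) ^ 2 := by
    have := sq_nonneg ((n : ℝ) * (m * (n * g)))
    linarith
  exact abs_le_of_sq_le_sq ((sq_entry_le_trace a i j).trans h4) (by positivity)

lemma exists_norm_bounds (n m : ℕ) : ∃ C : ℝ, 0 ≤ C ∧
    ∀ (a : Matrix (Fin n) (Fin n) ℝ) (b : Matrix (Fin n) (Fin m) ℝ) (g : ℝ), 0 < g →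
      IsNilpotent a → aᵀ + a - b * bᵀ = -(g • 1) →
      ‖a‖ ≤ C * g ∧ ‖aᵀ‖ ≤ C * g ∧ ‖b‖ ≤ C * √g ∧ ‖bᵀ‖ ≤ C * √g := by
  refine ⟨n * (n * (m * n)) + (m + n) * √n, by positivity, fun a b g hg ha h => ?_⟩
  have hs : 0 ≤ √g := Real.sqrt_nonneg g
  have hsn : 0 ≤ √(n : ℝ) := Real.sqrt_nonneg _
  have hn : (0 : ℝ) ≤ n := Nat.cast_nonneg n
  have hm : (0 : ℝ) ≤ m := Nat.cast_nonneg m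
  have hA := abs_entry_state_le hg ha h
  have hB := abs_entry_input_le ha h
  have a1 : ‖a‖ ≤ n * (n * (m * (n * g))) := by
    simpa using norm_le_card_mul (by positivity) hA
  have a2 : ‖aᵀ‖ ≤ n * (n * (m * (n * g))) := by
    simpa using norm_le_card_mul (X := aᵀ) (by positivity) fun i j => hA j i
  have b1 : ‖b‖ ≤ m * √(n * g) := by
    simpa using norm_le_card_mul (Real.sqrt_nonneg _) hB
  have b2 : ‖bᵀ‖ ≤ n * √(n * g) := by
    simpa using norm_le_card_mul (X := bᵀ) (Real.sqrt_nonneg _) fun i j => hB j i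
  rw [Real.sqrt_mul hn] at b1 b2
  have p1 : 0 ≤ (m + n) * √(n : ℝ) * g := by positivity
  have p2 : 0 ≤ n * (n * (m * n)) * √g := by positivity
  have p3 : 0 ≤ m * √(n : ℝ) * √g := by positivity
  have p4 : 0 ≤ n * √(n : ℝ) * √g := by positivity
  refine ⟨?_, ?_, ?_, ?_⟩ <;> linarith

lemma conj_pow {A M : Matrix (Fin n) (Fin n) ℝ} (hM : IsUnit M.det) (k : ℕ) :
    (M * A * M⁻¹) ^ k * M = M * A ^ k := by
  have h1 : M⁻¹ * M = 1 := Matrix.nonsing_inv_mul _ hM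
  induction k with
  | zero => simp
  | succ k ih =>
    calc (M * A * M⁻¹) ^ (k + 1) * M = (M * A * M⁻¹) ^ k * M * A * (M⁻¹ * M) := by
          rw [pow_succ]; simp only [Matrix.mul_assoc]
      _ = M * A ^ (k + 1) := by rw [ih, h1, pow_succ]; simp only [Matrix.mul_assoc, Matrix.mul_one]

lemma conj_pow_eq_zero {A M : Matrix (Fin n) (Fin n) ℝ} (hM : IsUnit M.det) {p : ℕ}
    (hA : A ^ p = 0) : (M * A * M⁻¹) ^ p = 0 := by
  have h1 : M * M⁻¹ = 1 := Matrix.mul_nonsing_inv _ hM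
  have := conj_pow (A := A) hM p
  calc (M * A * M⁻¹) ^ p = (M * A * M⁻¹) ^ p * M * M⁻¹ := by rw [Matrix.mul_assoc _ M, h1, mul_one]
    _ = 0 := by rw [this, hA]; simp

lemma exists_right_inverse_of_controllable {A : Matrix (Fin n) (Fin n) ℝ}
    {B : Matrix (Fin n) (Fin m) ℝ} (h : Controllable A B) :
    ∃ R : Matrix (Fin n × Fin m) (Fin n) ℝ,
      (Matrix.of fun (i : Fin n) (p : Fin n × Fin m) => (A ^ (p.1 : ℕ) * B) i p.2) * R = 1 := by
  refine Matrix.mulVec_surjective_iff_exists_right_inverse.1 ?_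
  have h1 := h
  unfold Controllable Matrix.rank at h1
  have h2 := Submodule.eq_top_of_finrank_eq (h1.trans (by simp : n = Module.finrank ℝ (Fin n → ℝ)))
  exact LinearMap.range_eq_top.1 h2

/-- Controllability gives `‖M‖ = O(√g)`, that is, `‖P(g)‖ = O(g)`. -/
lemma exists_factor_bound {A : Matrix (Fin n) (Fin n) ℝ} {B : Matrix (Fin n) (Fin m) ℝ}
    (hAB : Controllable A B) {C g0 : ℝ} (hC : 0 ≤ C) (hg0 : 0 < g0) : ∃ D : ℝ, 0 ≤ D ∧
    ∀ (M : Matrix (Fin n) (Fin n) ℝ) (g : ℝ), IsUnit M.det → 0 < g → g ≤ g0 →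
      ‖M * A * M⁻¹‖ ≤ C * g → ‖M * B‖ ≤ C * √g → ‖M‖ ≤ D * √g ∧ ‖Mᵀ‖ ≤ D * √g := by
  obtain ⟨R, hR⟩ := exists_right_inverse_of_controllable hAB
  set D := (n * m) * ((C * g0 + 1) ^ n * C) * ‖R‖ with hD
  have hD0 : 0 ≤ D := by positivity
  refine ⟨D + n * D, by positivity, fun M g hM hg hgg ha hb => ?_⟩
  have hs : 0 ≤ √g := Real.sqrt_nonneg g
  have hMn : ‖M‖ ≤ D * √g := by
    set K := (Matrix.of fun (i : Fin n) (p : Fin n × Fin m) => (A ^ (p.1 : ℕ) * B) i p.2)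
    have h1 : ‖M * K‖ ≤ Fintype.card (Fin n × Fin m) * ((C * g0 + 1) ^ n * (C * √g)) := by
      refine norm_le_card_mul (by positivity) fun i p => ?_
      have h2 : (M * K) i p = ((M * A * M⁻¹) ^ (p.1 : ℕ) * (M * B)) i p.2 := by
        rw [← Matrix.mul_assoc, conj_pow hM, Matrix.mul_assoc, Matrix.mul_apply, Matrix.mul_apply]
        rfl
      rw [h2]
      refine (abs_entry_le_norm _ _ _).trans ((Matrix.linfty_opNorm_mul _ _).trans ?_)
      have h3 : ‖(M * A * M⁻¹) ^ (p.1 : ℕ)‖ ≤ (C * g0 + 1) ^ n := by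
        have : Nonempty (Fin n) := ⟨i⟩
        have h4 : ‖M * A * M⁻¹‖ ≤ C * g0 + 1 := by nlinarith
        calc _ ≤ ‖M * A * M⁻¹‖ ^ (p.1 : ℕ) := norm_pow_le _ _
          _ ≤ (C * g0 + 1) ^ (p.1 : ℕ) := by gcongr
          _ ≤ _ := pow_le_pow_right₀ (by nlinarith) p.1.2.le
      gcongr
    calc ‖M‖ = ‖M * K * R‖ := by rw [Matrix.mul_assoc, hR, Matrix.mul_one]
      _ ≤ ‖M * K‖ * ‖R‖ := Matrix.linfty_opNorm_mul _ _
      _ ≤ (Fintype.card (Fin n × Fin m) * ((C * g0 + 1) ^ n * (C * √g))) * ‖R‖ := by gcongr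
      _ = D * √g := by simp [hD]; ring
  have hMT : ‖Mᵀ‖ ≤ n * (D * √g) := by
    simpa using norm_le_card_mul (X := Mᵀ) (by positivity)
      fun i j => (abs_entry_le_norm M j i).trans hMn
  have := mul_nonneg hD0 hs
  have : 0 ≤ n * (D * √g) := by positivity
  constructor <;> linarith

lemma lyap_conj {A M : Matrix (Fin n) (Fin n) ℝ} (hM : IsUnit M.det)
    (X : Matrix (Fin n) (Fin n) ℝ) :
    lyap (M * A * M⁻¹) (M * X * Mᵀ) = M * lyap A X * Mᵀ := by
  have h1 : M⁻¹ * M = 1 := Matrix.nonsing_inv_mul _ hM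
  have h2 : Mᵀ * (Mᵀ)⁻¹ = 1 := Matrix.mul_nonsing_inv _ (by rwa [Matrix.det_transpose])
  rw [lyap_apply, lyap_apply, Matrix.mul_add, Matrix.add_mul, Matrix.transpose_mul,
    Matrix.transpose_mul, Matrix.transpose_nonsing_inv]
  congr 1
  · calc _ = M * A * (M⁻¹ * M) * X * Mᵀ := by simp only [Matrix.mul_assoc]
      _ = _ := by rw [h1]; simp only [Matrix.mul_assoc, Matrix.one_mul]
  · calc _ = M * X * (Mᵀ * (Mᵀ)⁻¹) * Aᵀ * Mᵀ := by simp only [Matrix.mul_assoc]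
      _ = _ := by rw [h2]; simp only [Matrix.mul_assoc, Matrix.one_mul]

/-- A solution `e` of `ae + eaᵀ + ge = -1` is `O(1/g)` when `a` is nilpotent and `O(g)`. -/
lemma norm_le_of_lyap_eq {a e : Matrix (Fin n) (Fin n) ℝ} {p : ℕ} (ha : a ^ p = 0) {C g : ℝ}
    (hg : 0 < g) (h1 : ‖a‖ ≤ C * g) (h2 : ‖aᵀ‖ ≤ C * g) (he : lyap a e + g • e = -1) :
    ‖e‖ ≤ (∑ k ∈ Finset.range (2 * p), (2 * C) ^ k * ‖(1 : Matrix (Fin n) (Fin n) ℝ)‖) / g := by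
  rw [eq_sum_of_nilpotent (lyap_pow_eq_zero ha) hg.ne' he, Finset.sum_div]
  refine norm_sum_le_of_le _ fun k _ => ?_
  rw [norm_smul, map_neg, norm_neg, norm_mul, norm_pow, norm_neg, norm_one, one_pow, one_mul,
    norm_pow, Real.norm_of_nonneg (by positivity)]
  calc _ ≤ g⁻¹ ^ (k + 1) * ((2 * C * g) ^ k * ‖(1 : Matrix (Fin n) (Fin n) ℝ)‖) := by
        gcongr
        refine (norm_lyap_pow_le _ _ _).trans ?_
        gcongr
        linarith
    _ = _ := by
        rw [mul_pow _ g, pow_succ, inv_pow]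
        field_simp

end Scaled

section Solution

variable {n m : ℕ}

lemma det_isUnit_of_isPLESol {A : Matrix (Fin n) (Fin n) ℝ} {B : Matrix (Fin n) (Fin m) ℝ} {g : ℝ}
    {P : Matrix (Fin n) (Fin n) ℝ} (hP : IsPLESol A B g P) : IsUnit P.det :=
  (Matrix.isUnit_iff_isUnit_det _).1 hP.2.1.isUnit

lemma lyap_inv_eq {A : Matrix (Fin n) (Fin n) ℝ} {B : Matrix (Fin n) (Fin m) ℝ} {g : ℝ}
    {P : Matrix (Fin n) (Fin n) ℝ} (hP : IsPLESol A B g P) :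
    lyap A P⁻¹ + g • P⁻¹ = B * Bᵀ := by
  have hu := det_isUnit_of_isPLESol hP
  have h1 : P⁻¹ * P = 1 := Matrix.nonsing_inv_mul _ hu
  have h2 : P * P⁻¹ = 1 := Matrix.mul_nonsing_inv _ hu
  have h3 := congrArg (fun X => P⁻¹ * X * P⁻¹) hP.2.2
  simp only [Matrix.mul_sub, Matrix.mul_add, Matrix.sub_mul, Matrix.add_mul, Matrix.mul_neg,
    Matrix.neg_mul, Matrix.mul_smul, Matrix.smul_mul] at h3
  have e1 : P⁻¹ * (Aᵀ * P) * P⁻¹ = P⁻¹ * Aᵀ := by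
    simp only [Matrix.mul_assoc, h2, Matrix.mul_one]
  have e2 : P⁻¹ * (P * A) * P⁻¹ = A * P⁻¹ := by
    simp only [← Matrix.mul_assoc, h1, Matrix.one_mul]
  have e3 : P⁻¹ * (P * B * Bᵀ * P) * P⁻¹ = B * Bᵀ := by
    calc _ = (P⁻¹ * P) * B * Bᵀ * (P * P⁻¹) := by simp only [Matrix.mul_assoc]
      _ = _ := by rw [h1, h2, Matrix.one_mul, Matrix.mul_one]
  have e4 : P⁻¹ * P * P⁻¹ = P⁻¹ := by rw [h1, Matrix.one_mul]
  rw [e1, e2, e3, e4] at h3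
  rw [lyap_apply, ← sub_eq_zero]
  rw [← sub_eq_zero] at h3
  rw [← h3]
  abel

/-- The inverse solution `P(g)⁻¹` as an explicit polynomial in `g⁻¹`. -/
noncomputable def invSol (A : Matrix (Fin n) (Fin n) ℝ) (B : Matrix (Fin n) (Fin m) ℝ) (N : ℕ)
    (g : ℝ) : Matrix (Fin n) (Fin n) ℝ :=
  ∑ k ∈ Finset.range N, ((-1) ^ k * g⁻¹ ^ (k + 1)) • (lyap A ^ k) (B * Bᵀ)

lemma exists_hasDerivAt_invSol (A : Matrix (Fin n) (Fin n) ℝ) (B : Matrix (Fin n) (Fin m) ℝ)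
    (N : ℕ) {g : ℝ} (hg : 0 < g) : ∃ E, HasDerivAt (invSol A B N) E g := by
  have : DifferentiableAt ℝ (invSol A B N) g := by
    unfold invSol
    have h := hg.ne'
    fun_prop (disch := assumption)
  exact ⟨_, this.hasDerivAt⟩

lemma lyap_deriv_invSol {A : Matrix (Fin n) (Fin n) ℝ} {B : Matrix (Fin n) (Fin m) ℝ} {N : ℕ}
    {E : Matrix (Fin n) (Fin n) ℝ} {g : ℝ} (hg : 0 < g)
    (hW : ∀ h, 0 < h → lyap A (invSol A B N h) + h • invSol A B N h = B * Bᵀ)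
    (hE : HasDerivAt (invSol A B N) E g) : lyap A E + g • E = -invSol A B N g := by
  have h1 := ((hE.const_mul A).add (hE.mul_const Aᵀ)).add ((hasDerivAt_id g).smul hE)
  have h2 := h1.congr_of_eventuallyEq (f₁ := fun _ => B * Bᵀ)
    (by filter_upwards [lt_mem_nhds hg] with h hh using (hW h hh).symm)
  have h3 := h2.unique (hasDerivAt_const g (B * Bᵀ))
  rw [lyap_apply, eq_neg_iff_add_eq_zero, ← h3]
  simp [add_assoc]

lemma hasDerivAt_sol {P W : ℝ → Matrix (Fin n) (Fin n) ℝ} {E : Matrix (Fin n) (Fin n) ℝ} {g : ℝ}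
    (hg : 0 < g) (hdet : IsUnit (P g).det) (hW : ∀ h, 0 < h → (P h)⁻¹ = W h)
    (hdet' : ∀ h, 0 < h → IsUnit (P h).det) (hE : HasDerivAt W E g) :
    HasDerivAt P (-(P g * E * P g)) g := by
  have hP : ∀ h, 0 < h → P h = Ring.inverse (W h) := fun h hh => by
    rw [← Matrix.nonsing_inv_eq_ringInverse, ← hW h hh, Matrix.nonsing_inv_nonsing_inv _ (hdet' h hh)]
  have hWP : W g * P g = 1 := by rw [← hW g hg, Matrix.nonsing_inv_mul _ hdet]
  have hPW : P g * W g = 1 := by rw [← hW g hg, Matrix.mul_nonsing_inv _ hdet]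
  let U : (Matrix (Fin n) (Fin n) ℝ)ˣ := ⟨W g, P g, hWP, hPW⟩
  have h1 : HasFDerivAt Ring.inverse (-ContinuousLinearMap.mulLeftRight ℝ _ (P g) (P g)) (W g) :=
    hasFDerivAt_ringInverse (𝕜 := ℝ) U
  have h2 := h1.comp_hasDerivAt g hE
  refine (h2.congr_of_eventuallyEq ?_).congr_deriv ?_
  · filter_upwards [lt_mem_nhds hg] with h hh using hP h hh
  · simp

/-- Bounds on the solution `P` of the parametric Lyapunov equation and on its derivative `P'`,
relative to the quadratic form of `P`, for parameters in `(0, g0]`. -/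
structure SolBounds (A : Matrix (Fin n) (Fin n) ℝ) (B : Matrix (Fin n) (Fin m) ℝ)
    (P P' : ℝ → Matrix (Fin n) (Fin n) ℝ) (g0 C : ℝ) (N : ℕ) : Prop where
  nonneg : 0 ≤ C
  hasDerivAt : ∀ g, 0 < g → ∀ i j, HasDerivAt (fun h => P h i j) (P' g i j) g
  gain : ∀ g, 0 < g → g ≤ g0 → ∀ v, ‖(Bᵀ * P g) *ᵥ v‖ ≤ C * (√g * √(v ⬝ᵥ P g *ᵥ v))
  gain_state : ∀ g, 0 < g → g ≤ g0 → ∀ v,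
    ‖(Bᵀ * P g) *ᵥ (A *ᵥ v)‖ ≤ C * (g * √g * √(v ⬝ᵥ P g *ᵥ v))
  gain_vec : ∀ g, 0 < g → g ≤ g0 → ∀ v, ‖(Bᵀ * P g) *ᵥ v‖ ≤ C * (g * ‖v‖)
  form : ∀ g, 0 < g → g ≤ g0 → ∀ v w, |v ⬝ᵥ P g *ᵥ w| ≤ C * (√g * √(v ⬝ᵥ P g *ᵥ v) * ‖w‖)
  deriv_form : ∀ g, 0 < g → g ≤ g0 → ∀ v, |v ⬝ᵥ P' g *ᵥ v| ≤ C * (g⁻¹ * (v ⬝ᵥ P g *ᵥ v))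
  deriv_gain : ∀ g, 0 < g → g ≤ g0 → ∀ v,
    ‖(Bᵀ * P' g) *ᵥ v‖ ≤ C * (g⁻¹ * √g * √(v ⬝ᵥ P g *ᵥ v))
  norm_le : ∀ g, 0 < g → g ≤ g0 → ∀ v, ‖v‖ ≤ C * (g⁻¹ ^ N * √(v ⬝ᵥ P g *ᵥ v))

lemma exists_invSol_bound (A : Matrix (Fin n) (Fin n) ℝ) (B : Matrix (Fin n) (Fin m) ℝ)
    (N : ℕ) {g0 : ℝ} (hg0 : 0 < g0) : ∃ D : ℝ, 0 ≤ D ∧ ∀ g, 0 < g → g ≤ g0 →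
      ‖invSol A B N g‖ ≤ D * g⁻¹ ^ N := by
  refine ⟨∑ k ∈ Finset.range N, (g0 + 1) ^ N * ‖(lyap A ^ k) (B * Bᵀ)‖, by positivity,
    fun g hg hgg => ?_⟩
  rw [Finset.sum_mul]
  refine norm_sum_le_of_le _ fun k hk => ?_
  have hkN : k + 1 ≤ N := Finset.mem_range.1 hk
  rw [norm_smul, norm_mul, norm_pow, norm_neg, norm_one, one_pow, one_mul, norm_pow,
    Real.norm_of_nonneg (by positivity)]
  have h1 : g⁻¹ ^ (k + 1) = g ^ (N - (k + 1)) * g⁻¹ ^ N := by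
    obtain ⟨r, rfl⟩ := Nat.exists_eq_add_of_le hkN
    rw [Nat.add_sub_cancel_left, pow_add _ (k + 1) r, mul_left_comm, ← mul_pow,
      mul_inv_cancel₀ hg.ne', one_pow, mul_one]
  have h2 : g ^ (N - (k + 1)) ≤ (g0 + 1) ^ N := by
    calc _ ≤ (g0 + 1) ^ (N - (k + 1)) := by gcongr; linarith
      _ ≤ _ := pow_le_pow_right₀ (by linarith) (Nat.sub_le _ _)
  rw [h1]
  calc _ ≤ (g0 + 1) ^ N * g⁻¹ ^ N * ‖(lyap A ^ k) (B * Bᵀ)‖ := by gcongr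
    _ = _ := by ring

lemma exists_solBounds {A : Matrix (Fin n) (Fin n) ℝ} (hA : IsNilpotent A)
    {B : Matrix (Fin n) (Fin m) ℝ} (hAB : Controllable A B) {g0 : ℝ} (hg0 : 0 < g0)
    {P : ℝ → Matrix (Fin n) (Fin n) ℝ} (hP : ∀ g, 0 < g → IsPLESol A B g (P g)) :
    ∃ P' C N, SolBounds A B P P' g0 C N := by
  obtain ⟨p, hp⟩ := hA
  have hdet : ∀ h, 0 < h → IsUnit (P h).det := fun h hh => det_isUnit_of_isPLESol (hP h hh)
  have hW : ∀ h, 0 < h → (P h)⁻¹ = invSol A B (2 * p) h := fun h hh =>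
    eq_sum_of_nilpotent (lyap_pow_eq_zero hp) hh.ne' (lyap_inv_eq (hP h hh))
  have hEex : ∀ g : ℝ, ∃ E, 0 < g → HasDerivAt (invSol A B (2 * p)) E g := fun g => by
    by_cases hg : 0 < g
    · obtain ⟨E, hE⟩ := exists_hasDerivAt_invSol A B (2 * p) hg
      exact ⟨E, fun _ => hE⟩
    · exact ⟨0, fun h => absurd h hg⟩
  choose E hE using hEex
  have hEeq : ∀ g, 0 < g → lyap A (E g) + g • E g = -(P g)⁻¹ := fun g hg => by
    rw [hW g hg]
    exact lyap_deriv_invSol hg (fun h hh => hW h hh ▸ lyap_inv_eq (hP h hh)) (hE g hg)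
  obtain ⟨C, hC, hCb⟩ := exists_norm_bounds n m
  obtain ⟨D, hD, hDb⟩ := exists_factor_bound hAB hC hg0
  obtain ⟨F, hF, hFb⟩ := exists_invSol_bound A B (2 * p) hg0
  set e0 := ∑ k ∈ Finset.range (2 * p), (2 * C) ^ k * ‖(1 : Matrix (Fin n) (Fin n) ℝ)‖ with he0
  have he0n : 0 ≤ e0 := by positivity
  have key : ∀ g, 0 < g → g ≤ g0 → ∃ M : Matrix (Fin n) (Fin n) ℝ, P g = Mᵀ * M ∧
      ‖M * A * M⁻¹‖ ≤ C * g ∧ ‖(M * B)ᵀ‖ ≤ C * √g ∧ ‖M‖ ≤ D * √g ∧ ‖Mᵀ‖ ≤ D * √g ∧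
      ‖M * E g * Mᵀ‖ ≤ e0 / g ∧ M * A * M⁻¹ * M = M * A := by
    intro g hg hgg
    obtain ⟨M, hM, hPM⟩ := exists_factor (hP g hg).2.1
    have hs := scaled_equation hM (hPM ▸ hP g hg)
    have hnil := conj_pow_eq_zero hM hp
    obtain ⟨b1, b2, b3, b4⟩ := hCb _ _ g hg ⟨p, hnil⟩ hs
    obtain ⟨d1, d2⟩ := hDb M g hM hg hgg b1 b3
    refine ⟨M, hPM, b1, b4, d1, d2, norm_le_of_lyap_eq hnil hg b1 b2 ?_, ?_⟩
    · have hMT : IsUnit Mᵀ.det := by rwa [Matrix.det_transpose]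
      rw [lyap_conj hM]
      calc _ = M * (lyap A (E g) + g • E g) * Mᵀ := by
            simp [Matrix.mul_add, Matrix.add_mul]
        _ = -((M * M⁻¹) * ((Mᵀ)⁻¹ * Mᵀ)) := by
            rw [hEeq g hg, hPM, Matrix.mul_inv_rev]
            simp only [Matrix.mul_neg, Matrix.neg_mul, Matrix.mul_assoc]
        _ = -1 := by
            rw [Matrix.mul_nonsing_inv _ hM, Matrix.nonsing_inv_mul _ hMT, Matrix.mul_one]
    · rw [Matrix.mul_assoc, Matrix.nonsing_inv_mul _ hM, Matrix.mul_one]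
  have hz : ∀ (M : Matrix (Fin n) (Fin n) ℝ) (v w : Fin n → ℝ),
      v ⬝ᵥ (Mᵀ * M) *ᵥ w = (M *ᵥ v) ⬝ᵥ (M *ᵥ w) := fun M v w => by
    rw [← Matrix.mulVec_mulVec, Matrix.dotProduct_mulVec, Matrix.vecMul_transpose]
  have hzn : ∀ (M : Matrix (Fin n) (Fin n) ℝ) (v : Fin n → ℝ),
      ‖M *ᵥ v‖ ≤ √(v ⬝ᵥ (Mᵀ * M) *ᵥ v) := fun M v => by
    rw [hz]; exact Real.le_sqrt_of_sq_le (norm_sq_le_dotProduct_self _)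
  have hb : ∀ M : Matrix (Fin n) (Fin n) ℝ, Bᵀ * (Mᵀ * M) = (M * B)ᵀ * M := fun M => by
    rw [Matrix.transpose_mul, Matrix.mul_assoc]
  have mono : ∀ {c d x y : ℝ}, x ≤ c * y → 0 ≤ y → c ≤ d → x ≤ d * y := fun h1 h2 h3 =>
    h1.trans (mul_le_mul_of_nonneg_right h3 h2)
  have hn : (0 : ℝ) ≤ n := Nat.cast_nonneg n
  have q1 : 0 ≤ C * C := by positivity
  have q2 : 0 ≤ ‖Bᵀ‖ * (D * D) := by positivity
  have q3 : 0 ≤ n * D := by positivity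
  have q4 : 0 ≤ n * e0 := by positivity
  have q5 : 0 ≤ C * e0 := by positivity
  have q6 : 0 ≤ F * (D * √g0) := by positivity
  refine ⟨fun g => -(P g * E g * P g),
    C + C * C + ‖Bᵀ‖ * (D * D) + n * D + n * e0 + C * e0 + F * (D * √g0), 2 * p,
    by positivity, ?_, ?_, ?_, ?_, ?_, ?_, ?_, ?_⟩
  · intro g hg i j
    have := hasDerivAt_sol hg (hdet g hg) hW hdet (hE g hg)
    exact hasDerivAt_pi.1 (hasDerivAt_pi.1 this i) j
  · intro g hg hgg v
    obtain ⟨M, hPM, -, b4, -⟩ := key g hg hgg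
    refine mono (c := C) ?_ (by positivity) (by linarith)
    rw [hPM, hb, ← Matrix.mulVec_mulVec]
    calc _ ≤ ‖(M * B)ᵀ‖ * ‖M *ᵥ v‖ := Matrix.linfty_opNorm_mulVec _ _
      _ ≤ (C * √g) * √(v ⬝ᵥ (Mᵀ * M) *ᵥ v) := by gcongr; exact hzn M v
      _ = _ := by ring
  · intro g hg hgg v
    obtain ⟨M, hPM, b1, b4, -, -, -, hc⟩ := key g hg hgg
    refine mono (c := C * C) ?_ (by positivity) (by linarith)
    rw [hPM, hb, Matrix.mulVec_mulVec, Matrix.mul_assoc, ← hc, ← Matrix.mulVec_mulVec,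
      ← Matrix.mulVec_mulVec]
    calc _ ≤ ‖(M * B)ᵀ‖ * (‖M * A * M⁻¹‖ * ‖M *ᵥ v‖) :=
          (Matrix.linfty_opNorm_mulVec _ _).trans
            (mul_le_mul_of_nonneg_left (Matrix.linfty_opNorm_mulVec _ _) (norm_nonneg _))
      _ ≤ (C * √g) * ((C * g) * √(v ⬝ᵥ (Mᵀ * M) *ᵥ v)) := by gcongr; exact hzn M v
      _ = _ := by ring
  · intro g hg hgg v
    obtain ⟨M, hPM, -, -, d1, d2, -⟩ := key g hg hgg
    refine mono (c := ‖Bᵀ‖ * (D * D)) ?_ (by positivity) (by linarith)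
    rw [hPM]
    calc _ ≤ ‖Bᵀ * (Mᵀ * M)‖ * ‖v‖ := Matrix.linfty_opNorm_mulVec _ _
      _ ≤ (‖Bᵀ‖ * (‖Mᵀ‖ * ‖M‖)) * ‖v‖ := by
          gcongr
          exact (Matrix.linfty_opNorm_mul _ _).trans
            (mul_le_mul_of_nonneg_left (Matrix.linfty_opNorm_mul _ _) (norm_nonneg _))
      _ ≤ (‖Bᵀ‖ * ((D * √g) * (D * √g))) * ‖v‖ := by gcongr
      _ = ‖Bᵀ‖ * (D * D) * ((√g * √g) * ‖v‖) := by ring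
      _ = _ := by rw [Real.mul_self_sqrt hg.le]
  · intro g hg hgg v w
    obtain ⟨M, hPM, -, -, d1, d2, -⟩ := key g hg hgg
    refine mono (c := n * D) ?_ (by positivity) (by linarith)
    rw [hPM, hz M v w]
    calc _ ≤ n * (‖M *ᵥ v‖ * ‖M *ᵥ w‖) := by simpa using abs_dotProduct_le (M *ᵥ v) (M *ᵥ w)
      _ ≤ n * (√(v ⬝ᵥ (Mᵀ * M) *ᵥ v) * ((D * √g) * ‖w‖)) := by
          gcongr
          · exact hzn M v
          · exact (Matrix.linfty_opNorm_mulVec _ _).trans (by gcongr)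
      _ = _ := by ring
  · intro g hg hgg v
    obtain ⟨M, hPM, -, -, -, -, he, -⟩ := key g hg hgg
    have hV : 0 ≤ v ⬝ᵥ P g *ᵥ v := by
      rw [hPM, hz]; exact (sq_nonneg _).trans (norm_sq_le_dotProduct_self _)
    refine mono (c := n * e0) ?_ (by positivity) (by linarith)
    have h1 : v ⬝ᵥ -(P g * E g * P g) *ᵥ v = -((M *ᵥ v) ⬝ᵥ (M * E g * Mᵀ) *ᵥ (M *ᵥ v)) := by
      rw [Matrix.neg_mulVec, dotProduct_neg, ← Matrix.vecMul_transpose M v,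
        ← Matrix.dotProduct_mulVec, Matrix.vecMul_transpose, Matrix.mulVec_mulVec,
        Matrix.mulVec_mulVec, hPM]
      simp only [Matrix.mul_assoc]
    rw [h1, abs_neg]
    calc _ ≤ n * (‖M *ᵥ v‖ * ‖(M * E g * Mᵀ) *ᵥ (M *ᵥ v)‖) := by
          simpa only [Fintype.card_fin] using abs_dotProduct_le (M *ᵥ v) ((M * E g * Mᵀ) *ᵥ (M *ᵥ v))
      _ ≤ n * (√(v ⬝ᵥ P g *ᵥ v) * ((e0 / g) * √(v ⬝ᵥ P g *ᵥ v))) := by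
          rw [hPM]
          gcongr
          · exact hzn M v
          · exact (Matrix.linfty_opNorm_mulVec _ _).trans (by gcongr; exact hzn M v)
      _ = n * e0 * (g⁻¹ * (√(v ⬝ᵥ P g *ᵥ v) * √(v ⬝ᵥ P g *ᵥ v))) := by ring
      _ = _ := by rw [Real.mul_self_sqrt hV]
  · intro g hg hgg v
    obtain ⟨M, hPM, -, b4, -, -, he, -⟩ := key g hg hgg
    refine mono (c := C * e0) ?_ (by positivity) (by linarith)
    have h1 : (Bᵀ * -(P g * E g * P g)) *ᵥ v
        = -((M * B)ᵀ *ᵥ ((M * E g * Mᵀ) *ᵥ (M *ᵥ v))) := by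
      rw [Matrix.mul_neg, Matrix.neg_mulVec, Matrix.mulVec_mulVec, Matrix.mulVec_mulVec, hPM,
        Matrix.transpose_mul]
      simp only [Matrix.mul_assoc]
    rw [h1, norm_neg]
    calc _ ≤ ‖(M * B)ᵀ‖ * (‖M * E g * Mᵀ‖ * ‖M *ᵥ v‖) :=
          (Matrix.linfty_opNorm_mulVec _ _).trans
            (mul_le_mul_of_nonneg_left (Matrix.linfty_opNorm_mulVec _ _) (norm_nonneg _))
      _ ≤ (C * √g) * ((e0 / g) * √(v ⬝ᵥ P g *ᵥ v)) := by
          rw [hPM]; gcongr; exact hzn M v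
      _ = _ := by ring
  · intro g hg hgg v
    obtain ⟨M, hPM, -, -, d1, d2, -⟩ := key g hg hgg
    refine mono (c := F * (D * √g0)) ?_ (by positivity) (by linarith)
    have h1 : v = (invSol A B (2 * p) g) *ᵥ (Mᵀ *ᵥ (M *ᵥ v)) := by
      rw [Matrix.mulVec_mulVec, Matrix.mulVec_mulVec, Matrix.mul_assoc, ← hPM, ← hW g hg,
        Matrix.nonsing_inv_mul _ (hdet g hg), Matrix.one_mulVec]
    calc ‖v‖ = ‖(invSol A B (2 * p) g) *ᵥ (Mᵀ *ᵥ (M *ᵥ v))‖ := congrArg norm h1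
      _ ≤ ‖invSol A B (2 * p) g‖ * (‖Mᵀ‖ * ‖M *ᵥ v‖) :=
          (Matrix.linfty_opNorm_mulVec _ _).trans
            (mul_le_mul_of_nonneg_left (Matrix.linfty_opNorm_mulVec _ _) (norm_nonneg _))
      _ ≤ (F * g⁻¹ ^ (2 * p)) * ((D * √g0) * √(v ⬝ᵥ P g *ᵥ v)) := by
          rw [hPM]
          gcongr
          · exact hFb g hg hgg
          · exact d2.trans (by gcongr)
          · exact hzn M v
      _ = _ := by ring

end Solution

section Comparison

/-- Razumikhin-type comparison: if `y` starts below `K` and has negative derivative whenever it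
reaches `K` for the first time, then it never exceeds `K`. -/
lemma le_of_deriv_neg_at_crossing {y y' : ℝ → ℝ} {a T K : ℝ} (haT : a ≤ T)
    (hy : ∀ t ≥ T, HasDerivAt y (y' t) t) (hinit : ∀ s ∈ Set.Icc a T, y s < K)
    (hstep : ∀ t ≥ T, y t = K → (∀ s ∈ Set.Icc a t, y s ≤ K) → y' t < 0) :
    ∀ t ≥ a, y t ≤ K := by
  by_contra! hcon
  obtain ⟨t, hat, htK⟩ := hcon
  have hTt : T ≤ t := by
    by_contra! h
    exact absurd (hinit t ⟨hat, h.le⟩) htK.le.not_gt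
  have hcont : ContinuousOn y (Set.Icc T t) := fun s hs =>
    (hy s hs.1).continuousAt.continuousWithinAt
  have hcpt : IsCompact (Set.Icc T t ∩ y ⁻¹' Set.Ici K) :=
    isCompact_Icc.of_isClosed_subset (hcont.preimage_isClosed_of_isClosed isClosed_Icc isClosed_Ici)
      Set.inter_subset_left
  obtain ⟨c, ⟨⟨hTc, hct⟩, hcK⟩, hmin⟩ := hcpt.exists_isLeast ⟨t, ⟨hTt, le_rfl⟩, htK.le⟩
  have hlt : ∀ s, a ≤ s → s < c → y s < K := fun s has hsc => by
    rcases le_total s T with h | h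
    · exact hinit s ⟨has, h⟩
    · by_contra! h'
      exact absurd (hmin ⟨⟨h, hsc.le.trans hct⟩, h'⟩) hsc.not_ge
  have hTc' : T < c := lt_of_le_of_ne hTc fun h => by
    subst h
    exact absurd (hinit _ ⟨haT, le_rfl⟩) (not_lt.2 hcK)
  have hnear : ∀ᶠ s in nhdsWithin c (Set.Iio c), T < s ∧ s < c :=
    Ioo_mem_nhdsLT hTc'
  have hyc : y c = K := by
    refine le_antisymm (le_of_tendsto ((hy c hTc).continuousAt.continuousWithinAt
      (s := Set.Iio c)) ?_) hcK
    filter_upwards [hnear] with s hs using (hlt s (haT.trans hs.1.le) hs.2).le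
  have hneg := hstep c hTc hyc fun s hs => by
    rcases hs.2.lt_or_eq with h | h
    · exact (hlt s hs.1 h).le
    · rw [h, hyc]
  have hslope : ∀ᶠ s in nhdsWithin c (Set.Iio c), slope y c s < 0 :=
    (((hasDerivAt_iff_tendsto_slope.1 (hy c hTc)).mono_left
      (nhdsWithin_mono c fun s (hs : s < c) => hs.ne)).eventually_lt_const hneg)
  obtain ⟨s, hs, hs1, hs2⟩ := (hslope.and hnear).exists
  rw [slope_def_field, div_neg_iff] at hs
  have := hlt s (haT.trans hs1.le) hs2
  rcases hs with h | h <;> linarith [h.1, h.2]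

end Comparison

section Calculus

variable {ι κ : Type*} [Fintype κ]

lemma hasDerivAt_mulVec [Finite ι] {F : ℝ → Matrix ι κ ℝ} {F' : Matrix ι κ ℝ} {v : ℝ → κ → ℝ} {v' : κ → ℝ}
    {t : ℝ} (hF : ∀ i j, HasDerivAt (fun s => F s i j) (F' i j) t) (hv : HasDerivAt v v' t) :
    HasDerivAt (fun s => F s *ᵥ v s) (F' *ᵥ v t + F t *ᵥ v') t := by
  refine hasDerivAt_pi.2 fun i => ?_
  have := HasDerivAt.fun_sum (u := Finset.univ) fun j _ => (hF i j).mul (hasDerivAt_pi.1 hv j)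
  refine this.congr_deriv ?_
  simp [Matrix.mulVec, dotProduct, Finset.sum_add_distrib]

lemma hasDerivAt_dotProduct {v w : ℝ → κ → ℝ} {v' w' : κ → ℝ} {t : ℝ} (hv : HasDerivAt v v' t)
    (hw : HasDerivAt w w' t) :
    HasDerivAt (fun s => v s ⬝ᵥ w s) (v' ⬝ᵥ w t + v t ⬝ᵥ w') t := by
  have := HasDerivAt.fun_sum (u := Finset.univ) fun j _ =>
    (hasDerivAt_pi.1 hv j).mul (hasDerivAt_pi.1 hw j)
  refine this.congr_deriv ?_
  simp [dotProduct, Finset.sum_add_distrib]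

end Calculus

section ClosedLoop

variable {n m q : ℕ}

/-- The closed loop of the delayed system with the scheduled feedback `u = -BᵀP(γ(t))x`. -/
structure ClosedLoop (A : Matrix (Fin n) (Fin n) ℝ) (B : Matrix (Fin n) (Fin m) ℝ)
    (Bv : Fin q → Matrix (Fin n) (Fin m) ℝ) (τ : Fin q → ℝ → ℝ) (τbar : ℝ)
    (P P' : ℝ → Matrix (Fin n) (Fin n) ℝ) (g0 C : ℝ) (N : ℕ) (γ γ' : ℝ → ℝ)
    (x x' : ℝ → Fin n → ℝ) (u : ℝ → Fin m → ℝ) : Prop where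
  sum_eq : B = ∑ i, Bv i
  delay_bound_pos : 0 < τbar
  delay_nonneg : ∀ i, ∀ t ≥ 0, 0 ≤ τ i t
  delay_le : ∀ i, ∀ t ≥ 0, τ i t ≤ τbar
  sol : ∀ g, 0 < g → IsPLESol A B g (P g)
  bounds : SolBounds A B P P' g0 C N
  rate_pos : ∀ t ≥ 0, 0 < γ t
  rate_le : ∀ t ≥ 0, γ t ≤ g0
  rate_deriv : ∀ t > 0, HasDerivAt γ (γ' t) t
  state_deriv : ∀ t > 0, HasDerivAt x (x' t) t
  input_eq : ∀ t ≥ 0, u t = -((Bᵀ * P (γ t)) *ᵥ x t)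
  ode : ∀ t ≥ 0, x' t = A *ᵥ x t + ∑ i, Bv i *ᵥ u (t - τ i t)

variable {A : Matrix (Fin n) (Fin n) ℝ} {B : Matrix (Fin n) (Fin m) ℝ}
  {Bv : Fin q → Matrix (Fin n) (Fin m) ℝ} {τ : Fin q → ℝ → ℝ} {τbar : ℝ}
  {P P' : ℝ → Matrix (Fin n) (Fin n) ℝ} {g0 C : ℝ} {N : ℕ} {γ γ' : ℝ → ℝ}
  {x x' : ℝ → Fin n → ℝ} {u : ℝ → Fin m → ℝ}

/-- The Lyapunov function `x(t)ᵀP(γ(t))x(t)`. -/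
noncomputable def storage (P : ℝ → Matrix (Fin n) (Fin n) ℝ) (γ : ℝ → ℝ) (x : ℝ → Fin n → ℝ)
    (t : ℝ) : ℝ :=
  x t ⬝ᵥ P (γ t) *ᵥ x t

lemma dotProduct_mulVec_comm {S : Matrix (Fin n) (Fin n) ℝ} (hS : S.IsSymm) (v w : Fin n → ℝ) :
    v ⬝ᵥ S *ᵥ w = w ⬝ᵥ S *ᵥ v := by
  rw [Matrix.dotProduct_mulVec, ← Matrix.mulVec_transpose, hS.eq, dotProduct_comm]

lemma quadraticForm_nonneg {g : ℝ} {S : Matrix (Fin n) (Fin n) ℝ} (hS : IsPLESol A B g S)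
    (v : Fin n → ℝ) : 0 ≤ v ⬝ᵥ S *ᵥ v := by
  simpa using hS.2.1.posSemidef.dotProduct_mulVec_nonneg v

lemma two_mul_form_closedLoop_le {g : ℝ} {S : Matrix (Fin n) (Fin n) ℝ} (hS : IsPLESol A B g S)
    (v : Fin n → ℝ) :
    2 * (v ⬝ᵥ S *ᵥ (A *ᵥ v - B *ᵥ ((Bᵀ * S) *ᵥ v))) ≤ -g * (v ⬝ᵥ S *ᵥ v) := by
  have h := congrArg (fun X => v ⬝ᵥ X *ᵥ v) hS.2.2
  simp only [Matrix.sub_mulVec, Matrix.add_mulVec, Matrix.neg_mulVec, Matrix.smul_mulVec,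
    dotProduct_sub, dotProduct_add, dotProduct_neg, dotProduct_smul, smul_eq_mul] at h
  have h1 : v ⬝ᵥ (Aᵀ * S) *ᵥ v = v ⬝ᵥ S *ᵥ (A *ᵥ v) := by
    rw [dotProduct_mulVec_comm hS.1 v, ← Matrix.mulVec_mulVec, Matrix.dotProduct_mulVec,
      Matrix.vecMul_transpose]
  have h2 : v ⬝ᵥ (S * B * Bᵀ * S) *ᵥ v = ((Bᵀ * S) *ᵥ v) ⬝ᵥ ((Bᵀ * S) *ᵥ v) := by
    have : (Bᵀ * S)ᵀ = S * B := by rw [Matrix.transpose_mul, hS.1.eq, Matrix.transpose_transpose]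
    rw [Matrix.mul_assoc, ← Matrix.mulVec_mulVec, Matrix.dotProduct_mulVec, ← this,
      Matrix.vecMul_transpose]
  have h3 : v ⬝ᵥ S *ᵥ (B *ᵥ ((Bᵀ * S) *ᵥ v)) = v ⬝ᵥ (S * B * Bᵀ * S) *ᵥ v := by
    simp only [Matrix.mulVec_mulVec, Matrix.mul_assoc]
  have h4 : 0 ≤ ((Bᵀ * S) *ᵥ v) ⬝ᵥ ((Bᵀ * S) *ᵥ v) :=
    (sq_nonneg _).trans (norm_sq_le_dotProduct_self _)
  rw [h1, ← Matrix.mulVec_mulVec] at h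
  rw [Matrix.mulVec_sub, dotProduct_sub, h3]
  linarith

namespace ClosedLoop

variable (h : ClosedLoop A B Bv τ τbar P P' g0 C N γ γ' x x' u)
include h

lemma storage_nonneg {t : ℝ} (ht : 0 ≤ t) : 0 ≤ storage P γ x t :=
  quadraticForm_nonneg (h.sol _ (h.rate_pos t ht)) _

lemma hasDerivAt_sol_rate {t : ℝ} (ht : 0 < t) (i j : Fin n) :
    HasDerivAt (fun s => P (γ s) i j) ((γ' t • P' (γ t)) i j) t := by
  have := (h.bounds.hasDerivAt _ (h.rate_pos t ht.le) i j).comp t (h.rate_deriv t ht)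
  refine this.congr_deriv ?_
  simp [mul_comm]

lemma hasDerivAt_storage {t : ℝ} (ht : 0 < t) :
    HasDerivAt (storage P γ x)
      (2 * (x t ⬝ᵥ P (γ t) *ᵥ x' t) + γ' t * (x t ⬝ᵥ P' (γ t) *ᵥ x t)) t := by
  have h1 := h.state_deriv t ht
  have h2 := hasDerivAt_dotProduct h1 (hasDerivAt_mulVec (h.hasDerivAt_sol_rate ht) h1)
  refine h2.congr_deriv ?_
  rw [dotProduct_mulVec_comm (h.sol _ (h.rate_pos t ht.le)).1 (x' t), dotProduct_add,
    Matrix.smul_mulVec, dotProduct_smul, smul_eq_mul]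
  ring

lemma hasDerivAt_input {t : ℝ} (ht : 0 < t) :
    HasDerivAt u (-(γ' t • ((Bᵀ * P' (γ t)) *ᵥ x t) + (Bᵀ * P (γ t)) *ᵥ x' t)) t := by
  have h1 := hasDerivAt_mulVec (F := fun _ => Bᵀ) (F' := 0)
    (fun _ _ => hasDerivAt_const t _) (hasDerivAt_mulVec (h.hasDerivAt_sol_rate ht) (h.state_deriv t ht))
  refine (h1.neg.congr_of_eventuallyEq ?_).congr_deriv ?_
  · filter_upwards [lt_mem_nhds ht] with s hs
    rw [h.input_eq s hs.le, Pi.neg_apply, Matrix.mulVec_mulVec]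
  · rw [Matrix.zero_mulVec, zero_add, Matrix.mulVec_add, Matrix.smul_mulVec, Matrix.mulVec_smul,
      Matrix.mulVec_mulVec, Matrix.mulVec_mulVec]

/-- On a window where `γ` and the storage are controlled by their values at `t`, the input moves
at speed `O(γ^{3/2} V^{1/2})`. -/
lemma norm_input_deriv_le {κ D t : ℝ} (hκ : 0 ≤ κ) (ht : 2 * τbar < t)
    (hrate : ∀ s ∈ Set.Icc (t - 2 * τbar) t, γ s ≤ 2 * γ t)
    (hrate' : ∀ s ∈ Set.Icc (t - 2 * τbar) t, |γ' s| ≤ κ * γ s ^ 2)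
    (hV : ∀ s ∈ Set.Icc (t - 2 * τbar) t, √(storage P γ x s) ≤ D * √(storage P γ x t))
    {s : ℝ} (hs : s ∈ Set.Icc (t - τbar) t) :
    ‖-(γ' s • ((Bᵀ * P' (γ s)) *ᵥ x s) + (Bᵀ * P (γ s)) *ᵥ x' s)‖ ≤
      4 * C * D * (κ + 1 + C * ∑ i, ‖Bv i‖) * (γ t * √(γ t) * √(storage P γ x t)) := by
  have hτ := h.delay_bound_pos
  have hC := h.bounds.nonneg
  set R := √(storage P γ x t) with hR
  have hR0 : 0 ≤ R := Real.sqrt_nonneg _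
  have hs' : s ∈ Set.Icc (t - 2 * τbar) t := ⟨by linarith [hs.1], hs.2⟩
  have hs0 : 0 ≤ s := by linarith [hs.1]
  have ht0 : 0 ≤ t := by linarith
  have hgt := h.rate_pos t ht0
  have hgs := h.rate_pos s hs0
  have hgs2 := hrate s hs'
  have hsqrt : ∀ σ ∈ Set.Icc (t - 2 * τbar) t, √(γ σ) ≤ 2 * √(γ t) := fun σ hσ => by
    refine Real.sqrt_le_iff.2 ⟨by positivity, ?_⟩
    rw [mul_pow, Real.sq_sqrt hgt.le]
    linarith [hrate σ hσ]
  have hu : ∀ σ ∈ Set.Icc (t - 2 * τbar) t, ‖u σ‖ ≤ C * (2 * √(γ t) * (D * R)) := fun σ hσ => by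
    have hσ0 : 0 ≤ σ := by linarith [hσ.1]
    rw [h.input_eq σ hσ0, norm_neg]
    refine (h.bounds.gain _ (h.rate_pos σ hσ0) (h.rate_le σ hσ0) _).trans ?_
    gcongr
    · exact hsqrt σ hσ
    · exact hV σ hσ
  have h1 : ‖γ' s • ((Bᵀ * P' (γ s)) *ᵥ x s)‖ ≤ 4 * C * D * κ * (γ t * √(γ t) * R) := by
    rw [norm_smul, Real.norm_eq_abs]
    calc _ ≤ κ * γ s ^ 2 * (C * ((γ s)⁻¹ * √(γ s) * √(storage P γ x s))) :=
          mul_le_mul (hrate' s hs') (h.bounds.deriv_gain _ hgs (h.rate_le s hs0) _)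
            (norm_nonneg _) (by positivity)
      _ = κ * C * (γ s * √(γ s) * √(storage P γ x s)) := by field_simp
      _ ≤ κ * C * ((2 * γ t) * (2 * √(γ t)) * (D * R)) := by
          gcongr
          · exact hsqrt s hs'
          · exact hV s hs'
      _ = _ := by ring
  have h2 : ‖(Bᵀ * P (γ s)) *ᵥ (A *ᵥ x s)‖ ≤ 4 * C * D * (γ t * √(γ t) * R) := by
    calc _ ≤ C * (γ s * √(γ s) * √(storage P γ x s)) :=
          h.bounds.gain_state _ hgs (h.rate_le s hs0) _
      _ ≤ C * ((2 * γ t) * (2 * √(γ t)) * (D * R)) := by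
          gcongr
          · exact hsqrt s hs'
          · exact hV s hs'
      _ = _ := by ring
  have h3 : ‖(Bᵀ * P (γ s)) *ᵥ (∑ i, Bv i *ᵥ u (s - τ i s))‖ ≤
      4 * C * D * (C * ∑ i, ‖Bv i‖) * (γ t * √(γ t) * R) := by
    have h4 : ‖∑ i, Bv i *ᵥ u (s - τ i s)‖ ≤ (∑ i, ‖Bv i‖) * (C * (2 * √(γ t) * (D * R))) := by
      rw [Finset.sum_mul]
      refine norm_sum_le_of_le _ fun i _ => ?_
      refine (Matrix.linfty_opNorm_mulVec _ _).trans ?_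
      gcongr
      refine hu _ ⟨?_, ?_⟩
      · linarith [hs.1, h.delay_le i s hs0]
      · linarith [hs.2, h.delay_nonneg i s hs0]
    calc _ ≤ C * (γ s * ‖∑ i, Bv i *ᵥ u (s - τ i s)‖) :=
          h.bounds.gain_vec _ hgs (h.rate_le s hs0) _
      _ ≤ C * ((2 * γ t) * ((∑ i, ‖Bv i‖) * (C * (2 * √(γ t) * (D * R))))) := by gcongr
      _ = _ := by ring
  rw [norm_neg, h.ode s hs0, Matrix.mulVec_add]
  calc _ ≤ _ := (norm_add_le _ _).trans (add_le_add h1 ((norm_add_le _ _).trans (add_le_add h2 h3)))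
    _ = _ := by ring

lemma storage_deriv_le {κ D t : ℝ} (hκ : 0 ≤ κ) (hD : 0 ≤ D) (ht : 2 * τbar < t)
    (hrate : ∀ s ∈ Set.Icc (t - 2 * τbar) t, γ s ≤ 2 * γ t)
    (hrate' : ∀ s ∈ Set.Icc (t - 2 * τbar) t, |γ' s| ≤ κ * γ s ^ 2)
    (hV : ∀ s ∈ Set.Icc (t - 2 * τbar) t, √(storage P γ x s) ≤ D * √(storage P γ x t)) :
    2 * (x t ⬝ᵥ P (γ t) *ᵥ x' t) + γ' t * (x t ⬝ᵥ P' (γ t) *ᵥ x t) ≤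
      (-γ t + 2 * C * (∑ i, ‖Bv i‖) * (4 * C * D * (κ + 1 + C * ∑ i, ‖Bv i‖)) * τbar * γ t ^ 2
        + C * (|γ' t| * (γ t)⁻¹)) * storage P γ x t := by
  have hτ := h.delay_bound_pos
  have hC := h.bounds.nonneg
  have ht0 : 0 ≤ t := by linarith
  have hgt := h.rate_pos t ht0
  have hVt := h.storage_nonneg ht0
  set β := ∑ i, ‖Bv i‖ with hβ
  have hβ0 : 0 ≤ β := by positivity
  set c := 4 * C * D * (κ + 1 + C * β) with hc
  have hc0 : 0 ≤ c := by positivity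
  set R := √(storage P γ x t) with hR
  have hinc : ∀ i, ‖u (t - τ i t) - u t‖ ≤ c * (γ t * √(γ t) * R) * τbar := fun i => by
    have hd0 := h.delay_nonneg i t ht0
    have hd1 := h.delay_le i t ht0
    have := (convex_Icc (t - τbar) t).norm_image_sub_le_of_norm_hasDerivWithin_le (f := u)
      (fun s hs => (h.hasDerivAt_input (by linarith [hs.1])).hasDerivWithinAt)
      (fun s hs => h.norm_input_deriv_le hκ ht hrate hrate' hV hs)
      (Set.right_mem_Icc.2 (by linarith)) 
      (⟨by linarith, by linarith⟩ : t - τ i t ∈ Set.Icc (t - τbar) t)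
    refine this.trans ?_
    have : ‖t - τ i t - t‖ ≤ τbar := by
      rw [Real.norm_eq_abs, abs_le]; constructor <;> linarith
    gcongr
  have hsum : ‖∑ i, Bv i *ᵥ (u (t - τ i t) - u t)‖ ≤ β * (c * (γ t * √(γ t) * R) * τbar) := by
    rw [hβ, Finset.sum_mul]
    refine norm_sum_le_of_le _ fun i _ => (Matrix.linfty_opNorm_mulVec _ _).trans ?_
    exact mul_le_mul_of_nonneg_left (hinc i) (norm_nonneg _)
  have hsplit : x' t = (A *ᵥ x t - B *ᵥ ((Bᵀ * P (γ t)) *ᵥ x t))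
      + ∑ i, Bv i *ᵥ (u (t - τ i t) - u t) := by
    have : B *ᵥ ((Bᵀ * P (γ t)) *ᵥ x t) = -∑ i, Bv i *ᵥ u t := by
      rw [h.input_eq t ht0, ← Matrix.sum_mulVec, ← h.sum_eq, Matrix.mulVec_neg, neg_neg]
    rw [h.ode t ht0, this]
    simp only [Matrix.mulVec_sub, Finset.sum_sub_distrib]
    abel
  have h1 := two_mul_form_closedLoop_le (h.sol _ hgt) (x t)
  have h2 : x t ⬝ᵥ P (γ t) *ᵥ (∑ i, Bv i *ᵥ (u (t - τ i t) - u t)) ≤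
      C * β * c * τbar * γ t ^ 2 * storage P γ x t := by
    calc _ ≤ C * (√(γ t) * R * ‖∑ i, Bv i *ᵥ (u (t - τ i t) - u t)‖) :=
          (le_abs_self _).trans (h.bounds.form _ hgt (h.rate_le t ht0) _ _)
      _ ≤ C * (√(γ t) * R * (β * (c * (γ t * √(γ t) * R) * τbar))) := by gcongr
      _ = C * β * c * τbar * (√(γ t) * √(γ t)) * γ t * (R * R) := by ring
      _ = _ := by rw [Real.mul_self_sqrt hgt.le, Real.mul_self_sqrt hVt]; ring
  have h3 : γ' t * (x t ⬝ᵥ P' (γ t) *ᵥ x t) ≤ C * (|γ' t| * (γ t)⁻¹) * storage P γ x t := by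
    calc _ ≤ |γ' t| * |x t ⬝ᵥ P' (γ t) *ᵥ x t| := (le_abs_self _).trans (abs_mul _ _).le
      _ ≤ |γ' t| * (C * ((γ t)⁻¹ * storage P γ x t)) := by
          gcongr
          exact h.bounds.deriv_form _ hgt (h.rate_le t ht0) _
      _ = _ := by ring
  have h4 : x t ⬝ᵥ P (γ t) *ᵥ x t = storage P γ x t := rfl
  rw [hsplit, Matrix.mulVec_add, dotProduct_add]
  rw [h4] at h1
  linarith

end ClosedLoop

end ClosedLoop

section Convergence

variable {n m q : ℕ} {A : Matrix (Fin n) (Fin n) ℝ} {B : Matrix (Fin n) (Fin m) ℝ}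
  {Bv : Fin q → Matrix (Fin n) (Fin m) ℝ} {τ : Fin q → ℝ → ℝ} {τbar : ℝ}
  {P P' : ℝ → Matrix (Fin n) (Fin n) ℝ} {g0 C : ℝ} {N : ℕ} {γ γ' : ℝ → ℝ}
  {x x' : ℝ → Fin n → ℝ} {u : ℝ → Fin m → ℝ}

/-- If `γ` is slowly varying and decays strictly slower than `1 / t`, then the storage decays
faster than every power of `t`. -/
lemma ClosedLoop.exists_storage_mul_pow_le (h : ClosedLoop A B Bv τ τbar P P' g0 C N γ γ' x x' u)
    {ω κ : ℝ} (hω : 0 < ω) (hκ : 0 ≤ κ)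
    (hderiv_sq : ∀ t > 0, |γ' t| ≤ κ * γ t ^ 2)
    (hderiv : ∀ t > 0, |γ' t| * (γ t)⁻¹ ≤ ω * (ω * t + 1)⁻¹)
    (hdouble : ∀ s ≥ 0, ∀ t ≥ s, t ≤ 2 * s → γ s ≤ 2 * γ t)
    (hzero : Tendsto γ atTop (nhds 0))
    (hslow : Tendsto (fun t => (ω * t + 1)⁻¹ * (γ t)⁻¹) atTop (nhds 0)) (M : ℕ) :
    ∃ a K, ∀ t ≥ a, storage P γ x t * (ω * t + 1) ^ M ≤ K := by
  have hτ := h.delay_bound_pos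
  have hC := h.bounds.nonneg
  set k₁ := 2 * C * (∑ i, ‖Bv i‖) * (4 * C * 2 ^ M * (κ + 1 + C * ∑ i, ‖Bv i‖)) * τbar with hk₁
  set k₂ := C * ω + M * ω with hk₂
  have hsmall : Tendsto (fun t => k₁ * γ t + k₂ * ((ω * t + 1)⁻¹ * (γ t)⁻¹)) atTop (nhds 0) := by
    simpa using (hzero.const_mul k₁).add (hslow.const_mul k₂)
  obtain ⟨T, hT⟩ := ((hsmall.eventually_lt_const one_pos).and
    (eventually_ge_atTop (4 * τbar))).exists_forall_of_atTop
  have hT4 : 4 * τbar ≤ T := (hT T le_rfl).2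
  have hy : ∀ t > 0, HasDerivAt (fun s => storage P γ x s * (ω * s + 1) ^ M)
      ((2 * (x t ⬝ᵥ P (γ t) *ᵥ x' t) + γ' t * (x t ⬝ᵥ P' (γ t) *ᵥ x t)) * (ω * t + 1) ^ M
        + storage P γ x t * (M * (ω * t + 1)⁻¹ * ω * (ω * t + 1) ^ M)) t := fun t ht => by
    have hL : 0 < ω * t + 1 := by positivity
    have h1 := (((hasDerivAt_id t).const_mul ω).add_const 1).fun_pow M
    refine ((h.hasDerivAt_storage ht).mul h1).congr_deriv ?_
    rcases M with _ | M
    · simp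
    · simp only [id, mul_one, Nat.add_sub_cancel]
      field_simp
      ring
  have hcont : ContinuousOn (fun s => storage P γ x s * (ω * s + 1) ^ M)
      (Set.Icc (T - 2 * τbar) T) := fun s hs =>
    (hy s (by linarith [hs.1])).continuousAt.continuousWithinAt
  obtain ⟨K, hK⟩ := isCompact_Icc.bddAbove_image hcont
  refine ⟨T - 2 * τbar, max K 0 + 1, le_of_deriv_neg_at_crossing (by linarith)
    (fun t ht => hy t (by linarith)) (fun s hs => ?_) fun t ht htK hle => ?_⟩
  · exact lt_of_le_of_lt ((hK (Set.mem_image_of_mem _ hs)).trans (le_max_left _ _))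
      (lt_add_one _)
  have ht0 : 0 < t := by linarith
  have hL : 0 < ω * t + 1 := by positivity
  have hγ := h.rate_pos t ht0.le
  have hVpos : 0 < storage P γ x t := by
    refine (h.storage_nonneg ht0.le).lt_of_ne fun h0 => ?_
    rw [← h0, zero_mul] at htK
    linarith [le_max_right K 0]
  have hwin : ∀ s ∈ Set.Icc (t - 2 * τbar) t, √(storage P γ x s) ≤ 2 ^ M * √(storage P γ x t) :=
    fun s hs => by
    have hs0 : 0 < s := by linarith [hs.1]
    have hLs : 0 < ω * s + 1 := by positivity
    have h1 : storage P γ x s * (ω * s + 1) ^ M ≤ storage P γ x t * (ω * t + 1) ^ M := by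
      rw [htK]
      exact hle s ⟨by linarith [hs.1], hs.2⟩
    have h2 : (ω * t + 1) ^ M ≤ 2 ^ M * (ω * s + 1) ^ M := by
      rw [← mul_pow]
      refine pow_le_pow_left₀ hL.le ?_ _
      nlinarith [hs.1]
    have h3 : storage P γ x s ≤ 2 ^ M * storage P γ x t := by
      refine le_of_mul_le_mul_right ?_ (pow_pos hLs M)
      calc _ ≤ storage P γ x t * (2 ^ M * (ω * s + 1) ^ M) :=
            h1.trans (mul_le_mul_of_nonneg_left h2 hVpos.le)
        _ = _ := by ring
    refine Real.sqrt_le_iff.2 ⟨by positivity, h3.trans ?_⟩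
    rw [mul_pow, Real.sq_sqrt hVpos.le]
    gcongr
    exact le_self_pow₀ (one_le_pow₀ one_le_two) two_ne_zero
  have hdec := h.storage_deriv_le hκ (by positivity) (by linarith)
    (fun s hs => hdouble s (by linarith [hs.1]) t hs.2 (by linarith [hs.1]))
    (fun s hs => hderiv_sq s (by linarith [hs.1])) hwin
  rw [← hk₁] at hdec
  have hneg : -γ t + k₁ * γ t ^ 2 + C * (|γ' t| * (γ t)⁻¹) + M * (ω * t + 1)⁻¹ * ω < 0 := by
    have h1 := mul_le_mul_of_nonneg_left (hderiv t ht0) hC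
    have h2 : (k₁ * γ t + k₂ * ((ω * t + 1)⁻¹ * (γ t)⁻¹)) * γ t < 1 * γ t :=
      mul_lt_mul_of_pos_right (hT t ht).1 hγ
    have h3 : (k₁ * γ t + k₂ * ((ω * t + 1)⁻¹ * (γ t)⁻¹)) * γ t
        = k₁ * γ t ^ 2 + k₂ * (ω * t + 1)⁻¹ := by
      field_simp
    rw [h3, hk₂] at h2
    linarith
  calc _ ≤ ((-γ t + k₁ * γ t ^ 2 + C * (|γ' t| * (γ t)⁻¹)) * storage P γ x t) * (ω * t + 1) ^ M
        + storage P γ x t * (M * (ω * t + 1)⁻¹ * ω * (ω * t + 1) ^ M) := by gcongr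
    _ = (-γ t + k₁ * γ t ^ 2 + C * (|γ' t| * (γ t)⁻¹) + M * (ω * t + 1)⁻¹ * ω)
        * (storage P γ x t * (ω * t + 1) ^ M) := by ring
    _ < 0 := mul_neg_of_neg_of_pos hneg (by positivity)

lemma tendsto_affine_atTop {ω : ℝ} (hω : 0 < ω) :
    Tendsto (fun t : ℝ => ω * t + 1) atTop atTop :=
  tendsto_atTop_add_const_right _ _ (tendsto_id.const_mul_atTop hω)

lemma ClosedLoop.tendsto_zero (h : ClosedLoop A B Bv τ τbar P P' g0 C N γ γ' x x' u)
    {ω : ℝ} (hω : 0 < ω) (hg0 : 0 < g0)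
    (hlow : ∀ t ≥ 0, g0 * (ω * t + 1)⁻¹ ≤ γ t)
    (hdecay : ∀ M : ℕ, ∃ a K, ∀ t ≥ a, storage P γ x t * (ω * t + 1) ^ M ≤ K) :
    Tendsto x atTop (nhds 0) := by
  have hC := h.bounds.nonneg
  obtain ⟨a, K, hK⟩ := hdecay (2 * (N + 1))
  refine squeeze_zero_norm' (a := fun t => C * (g0⁻¹ ^ N * √K) * (ω * t + 1)⁻¹) ?_ ?_
  · filter_upwards [eventually_ge_atTop a, eventually_ge_atTop 0] with t hta ht
    have hLt : 0 < ω * t + 1 := by positivity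
    have hγ := h.rate_pos t ht
    refine (h.bounds.norm_le _ hγ (h.rate_le t ht) (x t)).trans ?_
    have h1 : √(storage P γ x t) * (ω * t + 1) ^ (N + 1) ≤ √K := by
      refine Real.le_sqrt_of_sq_le ?_
      rw [mul_pow, Real.sq_sqrt (h.storage_nonneg ht), ← pow_mul, mul_comm (N + 1) 2]
      exact hK t hta
    have h2 : (γ t)⁻¹ ≤ g0⁻¹ * (ω * t + 1) := by
      have := inv_anti₀ (by positivity) (hlow t ht)
      rwa [mul_inv, inv_inv] at this
    have h3 : √(x t ⬝ᵥ P (γ t) *ᵥ x t) = √(storage P γ x t) := rfl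
    rw [h3]
    calc C * ((γ t)⁻¹ ^ N * √(storage P γ x t))
        ≤ C * ((g0⁻¹ * (ω * t + 1)) ^ N * √(storage P γ x t)) := by gcongr
      _ = C * (g0⁻¹ ^ N * (√(storage P γ x t) * (ω * t + 1) ^ (N + 1))) * (ω * t + 1)⁻¹ := by
          rw [mul_pow]
          field_simp
          ring
      _ ≤ _ := by gcongr
  · simpa using (tendsto_affine_atTop hω).inv_tendsto_atTop.const_mul (C * (g0⁻¹ ^ N * √K))

end Convergence

section PowerRate

variable {γ0 ω μ : ℝ}

/-- The gain schedule `γ₀ / (ωt + 1)^μ`. -/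
noncomputable def powerRate (γ0 ω μ t : ℝ) : ℝ :=
  γ0 / (ω * t + 1) ^ μ

lemma powerRate_pos (hγ0 : 0 < γ0) (hω : 0 < ω) {t : ℝ} (ht : 0 ≤ t) :
    0 < powerRate γ0 ω μ t := by
  unfold powerRate
  positivity

lemma powerRate_le (hγ0 : 0 < γ0) (hω : 0 < ω) (hμ0 : 0 < μ) {t : ℝ} (ht : 0 ≤ t) :
    powerRate γ0 ω μ t ≤ γ0 := by
  have h1 : 1 ≤ ω * t + 1 := le_add_of_nonneg_left (by positivity)
  exact div_le_self hγ0.le (Real.one_le_rpow h1 hμ0.le)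

lemma mul_inv_le_powerRate (hγ0 : 0 < γ0) (hω : 0 < ω) (hμ1 : μ < 1) {t : ℝ} (ht : 0 ≤ t) :
    γ0 * (ω * t + 1)⁻¹ ≤ powerRate γ0 ω μ t := by
  have h1 : 1 ≤ ω * t + 1 := le_add_of_nonneg_left (by positivity)
  rw [powerRate, div_eq_mul_inv]
  gcongr
  simpa using Real.rpow_le_rpow_of_exponent_le h1 hμ1.le

lemma hasDerivAt_powerRate (hω : 0 < ω) {t : ℝ} (ht : 0 ≤ t) :
    HasDerivAt (powerRate γ0 ω μ) (-(μ * (ω * (ω * t + 1)⁻¹) * powerRate γ0 ω μ t)) t := by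
  have hL : 0 < ω * t + 1 := by positivity
  have h1 := ((((hasDerivAt_id t).const_mul ω).add_const 1).rpow_const (p := μ)
    (Or.inl (by simpa using hL.ne'))).fun_inv (by simpa using (Real.rpow_pos_of_pos hL μ).ne')
  have h2 := h1.const_mul γ0
  refine (h2.congr_of_eventuallyEq (Eventually.of_forall fun s => ?_)).congr_deriv ?_
  · simp [powerRate, div_eq_mul_inv]
  · simp only [id, mul_one, powerRate, Real.rpow_sub_one hL.ne']
    field_simp

lemma abs_deriv_powerRate_mul_inv_le (hγ0 : 0 < γ0) (hω : 0 < ω) (hμ0 : 0 < μ) (hμ1 : μ < 1)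
    {t : ℝ} (ht : 0 ≤ t) :
    |-(μ * (ω * (ω * t + 1)⁻¹) * powerRate γ0 ω μ t)| * (powerRate γ0 ω μ t)⁻¹
      ≤ ω * (ω * t + 1)⁻¹ := by
  have hγ := powerRate_pos (μ := μ) hγ0 hω ht
  rw [abs_neg, abs_of_nonneg (by positivity), mul_assoc, mul_inv_cancel₀ hγ.ne', mul_one]
  exact mul_le_of_le_one_left (by positivity) hμ1.le

lemma abs_deriv_powerRate_le (hγ0 : 0 < γ0) (hω : 0 < ω) (hμ0 : 0 < μ) (hμ1 : μ < 1)
    {t : ℝ} (ht : 0 ≤ t) :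
    |-(μ * (ω * (ω * t + 1)⁻¹) * powerRate γ0 ω μ t)|
      ≤ μ * ω / γ0 * powerRate γ0 ω μ t ^ 2 := by
  have hγ := powerRate_pos (μ := μ) hγ0 hω ht
  rw [abs_neg, abs_of_nonneg (by positivity)]
  calc _ = μ * ω / γ0 * (γ0 * (ω * t + 1)⁻¹) * powerRate γ0 ω μ t := by field_simp
    _ ≤ μ * ω / γ0 * powerRate γ0 ω μ t * powerRate γ0 ω μ t := by
        gcongr
        exact mul_inv_le_powerRate hγ0 hω hμ1 ht
    _ = _ := by ring

lemma powerRate_le_two_mul (hγ0 : 0 < γ0) (hω : 0 < ω) (hμ0 : 0 < μ) (hμ1 : μ < 1)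
    {s t : ℝ} (hs : 0 ≤ s) (hst : s ≤ t) (hts : t ≤ 2 * s) :
    powerRate γ0 ω μ s ≤ 2 * powerRate γ0 ω μ t := by
  have ht : 0 ≤ t := hs.trans hst
  have hLs : 0 < ω * s + 1 := by positivity
  have hLt : 0 < ω * t + 1 := by positivity
  have h1 : (ω * t + 1) ^ μ ≤ 2 * (ω * s + 1) ^ μ := by
    calc _ ≤ (2 * (ω * s + 1)) ^ μ := by
          refine Real.rpow_le_rpow hLt.le ?_ hμ0.le
          nlinarith
      _ = 2 ^ μ * (ω * s + 1) ^ μ := Real.mul_rpow two_pos.le hLs.le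
      _ ≤ _ := by
          gcongr
          simpa using Real.rpow_le_rpow_of_exponent_le one_le_two hμ1.le
  rw [powerRate, powerRate, ← mul_div_assoc, div_le_div_iff₀ (by positivity) (by positivity)]
  nlinarith

lemma tendsto_powerRate (hω : 0 < ω) (hμ0 : 0 < μ) :
    Tendsto (powerRate γ0 ω μ) atTop (nhds 0) :=
  ((tendsto_rpow_atTop hμ0).comp (tendsto_affine_atTop hω)).const_div_atTop γ0

lemma tendsto_inv_mul_inv_powerRate (hω : 0 < ω) (hμ1 : μ < 1) :
    Tendsto (fun t => (ω * t + 1)⁻¹ * (powerRate γ0 ω μ t)⁻¹) atTop (nhds 0) := by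
  have h1 := ((tendsto_rpow_neg_atTop (sub_pos.2 hμ1)).comp
    (tendsto_affine_atTop hω)).const_mul γ0⁻¹
  rw [mul_zero] at h1
  refine h1.congr' ?_
  filter_upwards [eventually_ge_atTop 0] with t ht
  have hL : 0 < ω * t + 1 := by positivity
  rw [Function.comp_apply, neg_sub, Real.rpow_sub_one hL.ne', powerRate, inv_div]
  ring

end PowerRate
end ParametricLyapunov

theorem state_feedback_asymptotic_stabilization
    {n m q : ℕ} (hn : 1 ≤ n) (hm : 1 ≤ m) (hq : 1 ≤ q)
    (A : Matrix (Fin n) (Fin n) ℝ) (hA : IsNilpotent A)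
    (Bv : Fin q → Matrix (Fin n) (Fin m) ℝ)
    (B : Matrix (Fin n) (Fin m) ℝ) (hB : B = ∑ i, Bv i)
    (hctrb : Controllable A B)
    (τbar d : ℝ) (hτbar : 0 < τbar) (hd0 : 0 ≤ d) (hd1 : d < 1)
    (τ τ' : Fin q → ℝ → ℝ)
    (hτdiff : ∀ i, ∀ t ≥ (0:ℝ), HasDerivWithinAt (τ i) (τ' i t) (Set.Ici 0) t)
    (hτlb : ∀ i, ∀ t ≥ (0:ℝ), 0 ≤ τ i t)
    (hτub : ∀ i, ∀ t ≥ (0:ℝ), τ i t ≤ τbar)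
    (hτ' : ∀ i, ∀ t ≥ (0:ℝ), τ' i t ≤ d)
    (γ0 ω μ : ℝ) (hγ0 : 0 < γ0) (hω : 0 < ω) (hμ0 : 0 < μ) (hμ1 : μ < 1)
    (γ : ℝ → ℝ) (hγ : ∀ t ≥ (0:ℝ), γ t = γ0 / (ω * t + 1) ^ μ)
    (P : ℝ → Matrix (Fin n) (Fin n) ℝ)
    (hP : ∀ g : ℝ, 0 < g → IsPLESol A B g (P g))
    (x x' : ℝ → Fin n → ℝ) (u : ℝ → Fin m → ℝ)
    (hxc : ContinuousOn x (Set.Ici (-τbar)))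
    (hxd : ∀ t ≥ (0:ℝ), HasDerivWithinAt x (x' t) (Set.Ici 0) t)
    (hub : ∃ M : ℝ, ∀ θ ∈ Set.Ico (-τbar) (0:ℝ), ‖u θ‖ ≤ M)
    (hu : ∀ t ≥ (0:ℝ), u t = -((Bᵀ * P (γ t)) *ᵥ x t))
    (hode : ∀ t ≥ (0:ℝ), x' t = A *ᵥ x t + ∑ i, Bv i *ᵥ u (t - τ i t)) :
    Tendsto x atTop (nhds 0) := by
  obtain ⟨P', C, N, hbounds⟩ :=
    ParametricLyapunov.exists_solBounds hA hctrb hγ0 hP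
  have hγ' : ∀ t ≥ 0, γ t = ParametricLyapunov.powerRate γ0 ω μ t := hγ
  have hloop : ParametricLyapunov.ClosedLoop A B Bv τ τbar P P' γ0 C N
      (ParametricLyapunov.powerRate γ0 ω μ)
      (fun t => -(μ * (ω * (ω * t + 1)⁻¹) * ParametricLyapunov.powerRate γ0 ω μ t)) x x' u :=
    { sum_eq := hB
      delay_bound_pos := hτbar
      delay_nonneg := hτlb
      delay_le := hτub
      sol := hP
      bounds := hbounds
      rate_pos := fun _ ht => ParametricLyapunov.powerRate_pos hγ0 hω ht
      rate_le := fun _ ht => ParametricLyapunov.powerRate_le hγ0 hω hμ0 ht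
      rate_deriv := fun _ ht => ParametricLyapunov.hasDerivAt_powerRate hω ht.le
      state_deriv := fun t ht => (hxd t ht.le).hasDerivAt (Ici_mem_nhds ht)
      input_eq := fun t ht => by rw [← hγ' t ht]; exact hu t ht
      ode := hode }
  exact hloop.tendsto_zero hω hγ0
    (fun t ht => ParametricLyapunov.mul_inv_le_powerRate hγ0 hω hμ1 ht)
    (hloop.exists_storage_mul_pow_le hω (by positivity : 0 ≤ μ * ω / γ0)
      (fun t ht => ParametricLyapunov.abs_deriv_powerRate_le hγ0 hω hμ0 hμ1 ht.le)
      (fun t ht => ParametricLyapunov.abs_deriv_powerRate_mul_inv_le hγ0 hω hμ0 hμ1 ht.le)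
      (fun s hs t hst hts => ParametricLyapunov.powerRate_le_two_mul hγ0 hω hμ0 hμ1 hs hst hts)
      (ParametricLyapunov.tendsto_powerRate hω hμ0)
      (ParametricLyapunov.tendsto_inv_mul_inv_powerRate hω hμ1))
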